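/- Variance bound for the measured self-information (key step in the proof of Theorem 2): Let ρ be a positive definite density matrix on ℂ^k. Let E^n be a PVM on (ℂ^k)^{⊗n} commuting with ρ^{⊗n} and satisfying 3 ≤ w(E^n) ≤ (n+1)^{k−1}, and let M^n be a rank-one PVM on (ℂ^k)^{⊗n} refining E^n. Then Σ_i P_{ρ^{⊗n}}^{M^n}(i) · ( (1/n) log P_{ρ^{⊗n}}^{M^n}(i) − Tr ρ log ρ )² ≤ 8 ( (k−1) log(n+1) / n )² + (2/n) · Tr( ρ (log ρ − (Tr ρ log ρ)·I)² ). -/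

import Mathlib

open scoped BigOperators Classical ComplexOrder
open Matrix Filter

noncomputable def matFun {d : Type*} [Fintype d] [DecidableEq d] (f : ℝ → ℝ)
    (A : Matrix d d ℂ) : Matrix d d ℂ :=
  if hA : A.IsHermitian then hA.cfc f else 0

noncomputable def matLog {d : Type*} [Fintype d] [DecidableEq d]
    (A : Matrix d d ℂ) : Matrix d d ℂ :=
  matFun Real.log A

noncomputable def tensPow {k : ℕ} (ρ : Matrix (Fin k) (Fin k) ℂ) (n : ℕ) :
    Matrix (Fin n → Fin k) (Fin n → Fin k) ℂ :=
  fun x y => ∏ i, ρ (x i) (y i)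

structure IsPVM {d ι : Type*} [Fintype d] [DecidableEq d] [Fintype ι]
    (E : ι → Matrix d d ℂ) : Prop where
  herm : ∀ i, (E i).IsHermitian
  idem : ∀ i, E i * E i = E i
  ne_zero : ∀ i, E i ≠ 0
  orth : ∀ i j, i ≠ j → E i * E j = 0
  sum_one : ∑ i, E i = 1

noncomputable def pvmWidth {d ι : Type*} [Fintype d] [DecidableEq d] [Fintype ι]
    (E : ι → Matrix d d ℂ) : ℕ :=
  Finset.univ.sup fun i => (E i).rank

def Refines {d ι κ : Type*} [Fintype d] [DecidableEq d] [Fintype ι] [Fintype κ]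
    (M : κ → Matrix d d ℂ) (E : ι → Matrix d d ℂ) : Prop :=
  ∃ f : κ → ι, ∀ i, E i = ∑ j ∈ Finset.univ.filter (fun j => f j = i), M j

def IsTest {d : Type*} [Fintype d] [DecidableEq d] (A : Matrix d d ℂ) : Prop :=
  A.PosSemidef ∧ (1 - A).PosSemidef

noncomputable def pinch {d ι : Type*} [Fintype d] [DecidableEq d] [Fintype ι]
    (E : ι → Matrix d d ℂ) (A : Matrix d d ℂ) : Matrix d d ℂ :=
  ∑ i, E i * A * E i

/-- Quantum relative entropy `D(ρ‖σ) = Tr ρ (log ρ - log σ)`. -/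
noncomputable def qRelEnt {d : Type*} [Fintype d] [DecidableEq d]
    (ρ σ : Matrix d d ℂ) : ℝ :=
  (Matrix.trace (ρ * (matLog ρ - matLog σ))).re


lemma mul_log_inv_le_half {s : ℝ} (hs : 0 < s) : s * Real.log s⁻¹ ≤ 1 / 2 := by
  have h1 := Real.add_one_le_exp (Real.log s⁻¹ - 1)
  rw [Real.exp_sub, Real.exp_log (inv_pos.2 hs)] at h1
  have he : (2 : ℝ) ≤ Real.exp 1 := by
    have := Real.exp_one_gt_d9
    linarith
  have h2 : s⁻¹ / Real.exp 1 ≤ s⁻¹ / 2 := by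
    have := inv_pos.2 hs
    gcongr
  calc s * Real.log s⁻¹ ≤ s * (s⁻¹ / 2) := by
        gcongr
        linarith
    _ = 1 / 2 := by field_simp

lemma mul_log_sq_le_one {s : ℝ} (hs : 0 < s) (hs1 : s ≤ 1) : s * Real.log s ^ 2 ≤ 1 := by
  have h1 := mul_log_inv_le_half (Real.sqrt_pos.2 hs)
  have h2 : 0 ≤ √s * Real.log (√s)⁻¹ :=
    mul_nonneg (Real.sqrt_nonneg _) (Real.log_nonneg (by
      rw [one_le_inv₀ (Real.sqrt_pos.2 hs)]
      exact Real.sqrt_le_one.2 hs1))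
  have h3 : s * Real.log s ^ 2 = 4 * (√s * Real.log (√s)⁻¹) ^ 2 := by
    rw [mul_pow, Real.sq_sqrt hs.le, Real.log_inv, Real.log_sqrt hs.le]
    ring
  rw [h3]
  nlinarith

/-- Splitting at the uniform weight `1 / w` bounds `t (log t)²` by terms summing to
`(log w)² + log w + 1` over at most `w` weights. -/
lemma mul_log_sq_le_of_one_le {t w : ℝ} (ht : 0 < t) (ht1 : t ≤ 1) (hw : 1 ≤ w) :
    t * Real.log t ^ 2 ≤ t * Real.log w ^ 2 + (Real.log w + 1) / w := by
  have hw0 : 0 < w := by linarith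
  have hL : 0 ≤ Real.log w := Real.log_nonneg hw
  rcases le_total 1 (t * w) with h | h
  · have h1 : Real.log t ^ 2 ≤ Real.log w ^ 2 := by
      have h2 := Real.log_nonneg h
      rw [Real.log_mul ht.ne' hw0.ne'] at h2
      have h3 := Real.log_nonpos ht.le ht1
      nlinarith
    have h2 : 0 ≤ (Real.log w + 1) / w := by positivity
    nlinarith
  · have hs : 0 < t * w := by positivity
    have h1 := mul_log_inv_le_half hs
    have h2 := mul_log_sq_le_one hs h
    have h3 : t * Real.log t ^ 2 = t * Real.log w ^ 2
        + (2 * Real.log w * (t * w * Real.log (t * w)⁻¹) + t * w * Real.log (t * w) ^ 2) / w := by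
      rw [Real.log_inv, Real.log_mul ht.ne' hw0.ne']
      field_simp
      ring
    rw [h3]
    gcongr
    nlinarith

/-- Pointwise bound on the squared log-likelihood ratio between an eigenvalue `l` and an outcome
probability `p`, where `q` is their overlap and `m` the mass of the block containing the outcome. -/
lemma mul_log_sub_log_sq_le {l q p m w : ℝ} (hl : 0 < l) (hq : 0 ≤ q) (hqm : q ≤ m)
    (hqp : l * q ≤ p) (hp : l * q ≤ p * m) (hw : 1 ≤ w) :
    l * q * (Real.log p - Real.log l) ^ 2
      ≤ l * q * Real.log w ^ 2 + l * m * ((Real.log w + 1) / w) + p * q := by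
  have hL : 0 ≤ Real.log w := Real.log_nonneg hw
  rcases hq.eq_or_lt with rfl | hq
  · have : 0 ≤ l * m * ((Real.log w + 1) / w) := by positivity
    simpa using this
  have hp0 : 0 < p := lt_of_lt_of_le (by positivity) hqp
  have hm : 0 < m := lt_of_lt_of_le hq hqm
  rcases le_total l p with h | h
  · have h1 := mul_log_sq_le_one (div_pos hl hp0) ((div_le_one hp0).2 h)
    rw [Real.log_div hl.ne' hp0.ne'] at h1
    have h2 : l * q * (Real.log p - Real.log l) ^ 2
        = p * q * (l / p * (Real.log l - Real.log p) ^ 2) := by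
      field_simp
      ring
    have h3 : 0 ≤ l * m * ((Real.log w + 1) / w) := by positivity
    have h4 : 0 ≤ l * q * Real.log w ^ 2 := by positivity
    have h5 := mul_le_mul_of_nonneg_left h1 (by positivity : 0 ≤ p * q)
    linarith
  · have ht : 0 < q / m := div_pos hq hm
    have h1 := mul_log_sq_le_of_one_le ht ((div_le_one hm).2 hqm) hw
    have h2 : (Real.log p - Real.log l) ^ 2 ≤ Real.log (q / m) ^ 2 := by
      have h3 : Real.log (q / m) ≤ Real.log p - Real.log l := by
        rw [← Real.log_div hp0.ne' hl.ne']
        apply Real.log_le_log ht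
        rw [div_le_div_iff₀ hm hl]
        linarith
      have h4 : Real.log p ≤ Real.log l := Real.log_le_log hp0 h
      nlinarith
    have h3 : l * q * (Real.log p - Real.log l) ^ 2 ≤ l * m * (q / m * Real.log (q / m) ^ 2) := by
      have : l * m * (q / m * Real.log (q / m) ^ 2) = l * q * Real.log (q / m) ^ 2 := by
        field_simp
      rw [this]
      gcongr
    have h4 := mul_le_mul_of_nonneg_left h1 (by positivity : 0 ≤ l * m)
    have h5 : l * m * (q / m * Real.log w ^ 2 + (Real.log w + 1) / w)
        = l * q * Real.log w ^ 2 + l * m * ((Real.log w + 1) / w) := by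
      field_simp
    have h6 : 0 ≤ p * q := by positivity
    linarith

lemma sum_mul_log_sub_log_sq_le {α κ ι : Type*} [Fintype α] [Fintype κ] [Fintype ι]
    (l : α → ℝ) (q : α → κ → ℝ) (p : κ → ℝ) (f : κ → ι) (w : ℕ)
    (hl : ∀ a, 0 < l a) (hl1 : ∑ a, l a = 1) (hq : ∀ a i, 0 ≤ q a i)
    (hq1 : ∀ a, ∑ i, q a i = 1) (hq2 : ∀ i, ∑ a, q a i = 1)
    (hp : ∀ i, p i = ∑ a, l a * q a i)
    (hm : ∀ a i, l a * q a i ≤ p i * ∑ j with f j = f i, q a j)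
    (hw3 : 3 ≤ w) (hw : ∀ e, (Finset.univ.filter fun i => f i = e).card ≤ w) :
    ∑ a, ∑ i, l a * q a i * (Real.log (p i) - Real.log (l a)) ^ 2 ≤ 4 * Real.log w ^ 2 := by
  have hw3' : (3 : ℝ) ≤ w := by exact_mod_cast hw3
  have hw0 : (0 : ℝ) < w := by linarith
  have hL : 1 ≤ Real.log w := by
    rw [Real.le_log_iff_exp_le hw0]
    have := Real.exp_one_lt_d9
    linarith
  have hpsum : ∑ i, p i = 1 := by
    simp_rw [hp]
    rw [Finset.sum_comm]
    simp_rw [← Finset.mul_sum, hq1, mul_one, hl1]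
  have hblock : ∀ a, ∑ i, ∑ j with f j = f i, q a j ≤ w := by
    intro a
    have h1 : ∑ i, ∑ j with f j = f i, q a j
        = ∑ j, q a j * (Finset.univ.filter fun i => f i = f j).card := by
      simp_rw [Finset.sum_filter]
      rw [Finset.sum_comm]
      refine Finset.sum_congr rfl fun j _ => ?_
      rw [← Finset.sum_filter, Finset.sum_const, nsmul_eq_mul, mul_comm]
      simp_rw [eq_comm]
    rw [h1]
    calc ∑ j, q a j * (Finset.univ.filter fun i => f i = f j).card ≤ ∑ j, q a j * w := by
          refine Finset.sum_le_sum fun j _ => mul_le_mul_of_nonneg_left ?_ (hq a j)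
          exact_mod_cast hw (f j)
      _ = w := by rw [← Finset.sum_mul, hq1, one_mul]
  calc ∑ a, ∑ i, l a * q a i * (Real.log (p i) - Real.log (l a)) ^ 2
      ≤ ∑ a, ∑ i, (l a * q a i * Real.log w ^ 2
          + l a * (∑ j with f j = f i, q a j) * ((Real.log w + 1) / w) + p i * q a i) := by
        refine Finset.sum_le_sum fun a _ => Finset.sum_le_sum fun i _ => ?_
        refine mul_log_sub_log_sq_le (hl a) (hq a i) ?_ ?_ (hm a i) (by linarith)
        · exact Finset.single_le_sum (f := q a) (fun j _ => hq a j) (by simp)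
        · rw [hp]
          exact Finset.single_le_sum (f := fun a => l a * q a i)
            (fun b _ => mul_nonneg (hl b).le (hq b i)) (Finset.mem_univ a)
    _ = Real.log w ^ 2 + (∑ a, l a * ∑ i, ∑ j with f j = f i, q a j) * ((Real.log w + 1) / w)
          + 1 := by
        simp_rw [Finset.sum_add_distrib, ← Finset.sum_mul, ← Finset.mul_sum, hq1, mul_one, hl1]
        rw [Finset.sum_comm]
        simp_rw [← Finset.mul_sum, hq2, mul_one, hpsum, one_mul]
    _ ≤ Real.log w ^ 2 + (∑ a, l a * w) * ((Real.log w + 1) / w) + 1 := by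
        have hc : 0 ≤ (Real.log w + 1) / w := by positivity
        have h1 : ∑ a, l a * ∑ i, ∑ j with f j = f i, q a j ≤ ∑ a, l a * w :=
          Finset.sum_le_sum fun a _ => mul_le_mul_of_nonneg_left (hblock a) (hl a).le
        have h2 := mul_le_mul_of_nonneg_right h1 hc
        linarith
    _ = Real.log w ^ 2 + Real.log w + 2 := by
        rw [← Finset.sum_mul, hl1]
        field_simp
        ring
    _ ≤ 4 * Real.log w ^ 2 := by nlinarith

/-- Moments of a sum of `n` independent centred variables. -/
lemma sum_prod_moments {β : Type*} [Fintype β] (μ g : β → ℝ) (hμ : ∑ b, μ b = 1)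
    (hg : ∑ b, μ b * g b = 0) (n : ℕ) :
    (∑ a : Fin n → β, ∏ j, μ (a j) = 1) ∧
    (∑ a : Fin n → β, (∏ j, μ (a j)) * ∑ j, g (a j) = 0) ∧
    (∑ a : Fin n → β, (∏ j, μ (a j)) * (∑ j, g (a j)) ^ 2 = n * ∑ b, μ b * g b ^ 2) := by
  induction n with
  | zero => simp
  | succ n ih =>
    obtain ⟨h0, h1, h2⟩ := ih
    have key : ∀ F : (Fin (n + 1) → β) → ℝ,
        ∑ a, F a = ∑ b, ∑ a : Fin n → β, F (Fin.cons b a) := by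
      intro F
      rw [← Fintype.sum_prod_type']
      exact (Equiv.sum_comp (Fin.consEquiv fun _ => β) F).symm
    refine ⟨?_, ?_, ?_⟩
    · rw [key]
      simp only [Fin.prod_univ_succ, Fin.cons_zero, Fin.cons_succ]
      simp_rw [← Finset.mul_sum, h0, mul_one, hμ]
    · rw [key]
      simp only [Fin.prod_univ_succ, Fin.sum_univ_succ, Fin.cons_zero, Fin.cons_succ]
      have : ∀ b, ∑ a : Fin n → β, μ b * (∏ j, μ (a j)) * (g b + ∑ j, g (a j)) = μ b * g b := by
        intro b
        calc _ = μ b * g b * (∑ a : Fin n → β, ∏ j, μ (a j))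
              + μ b * ∑ a : Fin n → β, (∏ j, μ (a j)) * ∑ j, g (a j) := by
              rw [Finset.mul_sum, Finset.mul_sum, ← Finset.sum_add_distrib]
              exact Finset.sum_congr rfl fun a _ => by ring
          _ = _ := by rw [h0, h1]; ring
      simp_rw [this, hg]
    · rw [key]
      simp only [Fin.prod_univ_succ, Fin.sum_univ_succ, Fin.cons_zero, Fin.cons_succ]
      have : ∀ b, ∑ a : Fin n → β, μ b * (∏ j, μ (a j)) * (g b + ∑ j, g (a j)) ^ 2
          = μ b * g b ^ 2 + μ b * (n * ∑ b, μ b * g b ^ 2) := by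
        intro b
        calc _ = μ b * g b ^ 2 * (∑ a : Fin n → β, ∏ j, μ (a j))
              + 2 * μ b * g b * (∑ a : Fin n → β, (∏ j, μ (a j)) * ∑ j, g (a j))
              + μ b * ∑ a : Fin n → β, (∏ j, μ (a j)) * (∑ j, g (a j)) ^ 2 := by
              rw [Finset.mul_sum, Finset.mul_sum, Finset.mul_sum, ← Finset.sum_add_distrib,
                ← Finset.sum_add_distrib]
              exact Finset.sum_congr rfl fun a _ => by ring
          _ = _ := by rw [h0, h1, h2]; ring
      simp_rw [this]
      rw [Finset.sum_add_distrib, ← Finset.sum_mul, hμ]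
      push_cast
      ring

lemma trace_eq_rank_of_idem {d : Type*} [Fintype d] [DecidableEq d] {A : Matrix d d ℂ}
    (hA : A * A = A) : A.trace = A.rank := by
  have h : IsIdempotentElem (Matrix.toLin' A) := by
    rw [IsIdempotentElem, Module.End.mul_eq_comp, ← Matrix.toLin'_mul, hA]
  have := (LinearMap.IsIdempotentElem.isProj_range _ h).trace
  rw [Matrix.trace_toLin'_eq] at this
  rw [this]
  rfl

lemma sum_norm_sq_row {d : Type*} [Fintype d] {A : Matrix d d ℂ}
    (hA : A.IsHermitian) (hA2 : A * A = A) (a : d) : ∑ b, ‖A a b‖ ^ 2 = (A a a).re := by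
  conv_rhs => rw [← hA2, Matrix.mul_apply, Complex.re_sum]
  refine Finset.sum_congr rfl fun b _ => ?_
  rw [← hA.apply b a, Complex.star_def, Complex.mul_conj, Complex.ofReal_re, Complex.normSq_eq_norm_sq]

lemma norm_sq_entry_le {d : Type*} [Fintype d] {A : Matrix d d ℂ}
    (hA : A.IsHermitian) (hA2 : A * A = A) (a b : d) :
    ‖A a b‖ ^ 2 ≤ (A a a).re * (A b b).re := by
  have hcol : ∀ c, ‖A c b‖ = ‖A b c‖ := fun c => by rw [← hA.apply b c, norm_star]
  have h1 : ‖A a b‖ ≤ ∑ c, ‖A a c‖ * ‖A b c‖ := by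
    conv_lhs => rw [← hA2, Matrix.mul_apply]
    refine (norm_sum_le _ _).trans_eq (Finset.sum_congr rfl fun c _ => ?_)
    rw [norm_mul, hcol]
  calc ‖A a b‖ ^ 2 ≤ (∑ c, ‖A a c‖ * ‖A b c‖) ^ 2 := by gcongr
    _ ≤ (∑ c, ‖A a c‖ ^ 2) * ∑ c, ‖A b c‖ ^ 2 := Finset.sum_mul_sq_le_sq_mul_sq _ _ _
    _ = _ := by rw [sum_norm_sq_row hA hA2, sum_norm_sq_row hA hA2]

/-- If a projection `P` lies below a projection `F` commuting with the positive diagonal matrix `l`,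
then `l a * P a a ≤ F a a * Tr (P l)`. -/
lemma mul_diag_le_of_commute {d : Type*} [Fintype d] [DecidableEq d] {P F : Matrix d d ℂ}
    {l : d → ℝ} (hl : ∀ a, 0 < l a) (hP : P.IsHermitian) (hP2 : P * P = P)
    (hF : F.IsHermitian) (hF2 : F * F = F) (hFP : F * P = P)
    (hc : F * diagonal (fun a => (l a : ℂ)) = diagonal (fun a => (l a : ℂ)) * F) (a : d) :
    l a * (P a a).re ≤ (∑ b, l b * (P b b).re) * (F a a).re := by
  have hPnn : ∀ b, 0 ≤ (P b b).re := fun b => by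
    rw [← sum_norm_sq_row hP hP2]; positivity
  have hFnn : ∀ b, 0 ≤ (F b b).re := fun b => by
    rw [← sum_norm_sq_row hF hF2]; positivity
  have hcom : ∀ b, √(l a) * ‖F a b‖ = √(l b) * ‖F a b‖ := by
    intro b
    have h := congrFun (congrFun hc a) b
    rw [Matrix.mul_diagonal, Matrix.diagonal_mul] at h
    by_cases h0 : F a b = 0
    · simp [h0]
    · have h2 : (l b : ℂ) = l a := mul_left_cancel₀ h0 (h.trans (mul_comm _ _))
      rw [Complex.ofReal_inj.1 h2]
  have hnorm : (P a a).re ≤ ∑ b, ‖F a b‖ * ‖P b a‖ := by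
    refine (Complex.re_le_norm _).trans ?_
    conv_lhs => rw [← hFP, Matrix.mul_apply]
    refine (norm_sum_le _ _).trans_eq (Finset.sum_congr rfl fun c _ => norm_mul _ _)
  have h1 : √(l a) * (P a a).re ≤ ∑ b, ‖F a b‖ * (√(l b) * ‖P b a‖) := by
    refine (mul_le_mul_of_nonneg_left hnorm (Real.sqrt_nonneg _)).trans_eq ?_
    rw [Finset.mul_sum]
    refine Finset.sum_congr rfl fun b _ => ?_
    rw [← mul_assoc, hcom]
    ring
  have h2 : l a * (P a a).re ^ 2 ≤ (F a a).re * ((∑ b, l b * (P b b).re) * (P a a).re) := by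
    calc l a * (P a a).re ^ 2 = (√(l a) * (P a a).re) ^ 2 := by
          rw [mul_pow, Real.sq_sqrt (hl a).le]
      _ ≤ (∑ b, ‖F a b‖ * (√(l b) * ‖P b a‖)) ^ 2 := by
          have := mul_nonneg (Real.sqrt_nonneg (l a)) (hPnn a)
          gcongr
      _ ≤ (∑ b, ‖F a b‖ ^ 2) * ∑ b, (√(l b) * ‖P b a‖) ^ 2 := Finset.sum_mul_sq_le_sq_mul_sq _ _ _
      _ ≤ (F a a).re * ((∑ b, l b * (P b b).re) * (P a a).re) := by
          rw [sum_norm_sq_row hF hF2]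
          refine mul_le_mul_of_nonneg_left ?_ (hFnn a)
          rw [Finset.sum_mul]
          refine Finset.sum_le_sum fun b _ => ?_
          rw [mul_pow, Real.sq_sqrt (hl b).le, mul_assoc]
          exact mul_le_mul_of_nonneg_left (norm_sq_entry_le hP hP2 b a) (hl b).le
  rcases (hPnn a).eq_or_lt with h0 | h0
  · rw [← h0, mul_zero]
    exact mul_nonneg (Finset.sum_nonneg fun b _ => mul_nonneg (hl b).le (hPnn b)) (hFnn a)
  · refine le_of_mul_le_mul_right ?_ h0
    linarith

lemma IsPVM.conj {d ι : Type*} [Fintype d] [DecidableEq d] [Fintype ι] {E : ι → Matrix d d ℂ}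
    (hE : IsPVM E) {V : Matrix d d ℂ} (hV : Vᴴ * V = 1) : IsPVM fun i => Vᴴ * E i * V := by
  have hV' : V * Vᴴ = 1 := mul_eq_one_comm.1 hV
  have hmul : ∀ A B : Matrix d d ℂ, Vᴴ * A * V * (Vᴴ * B * V) = Vᴴ * (A * B) * V := by
    intro A B
    calc _ = Vᴴ * A * (V * Vᴴ) * B * V := by simp only [Matrix.mul_assoc]
      _ = _ := by rw [hV', Matrix.mul_one, Matrix.mul_assoc Vᴴ A B]
  refine ⟨fun i => isHermitian_conjTranspose_mul_mul V (hE.herm i), fun i => ?_, fun i h => ?_,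
    fun i j hij => ?_, ?_⟩
  · rw [hmul, hE.idem]
  · apply hE.ne_zero i
    calc E i = V * Vᴴ * E i * (V * Vᴴ) := by rw [hV', Matrix.one_mul, Matrix.mul_one]
      _ = V * (Vᴴ * E i * V) * Vᴴ := by simp only [Matrix.mul_assoc]
      _ = 0 := by rw [h, Matrix.mul_zero, Matrix.zero_mul]
  · rw [hmul, hE.orth i j hij, Matrix.mul_zero, Matrix.zero_mul]
  · rw [← Finset.sum_mul, ← Finset.mul_sum, hE.sum_one, Matrix.mul_one, hV]

lemma IsPVM.trace_eq_one_of_pvmWidth_eq_one {d ι : Type*} [Fintype d] [DecidableEq d] [Fintype ι]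
    {M : ι → Matrix d d ℂ} (hM : IsPVM M) (hw : pvmWidth M = 1) (i : ι) :
    (M i).trace = 1 := by
  have h1 : (M i).rank ≤ 1 := hw ▸ Finset.le_sup (f := fun i => (M i).rank) (Finset.mem_univ i)
  have ht := trace_eq_rank_of_idem (hM.idem i)
  have h2 : (M i).rank ≠ 0 := fun h => hM.ne_zero i (by
    rw [Matrix.rank, Submodule.finrank_eq_zero, LinearMap.range_eq_bot] at h
    rwa [← Matrix.toLin'_apply', LinearEquiv.map_eq_zero_iff] at h)
  rw [ht, show (M i).rank = 1 by omega, Nat.cast_one]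

lemma tensPow_mul {k : ℕ} (A B : Matrix (Fin k) (Fin k) ℂ) (n : ℕ) :
    tensPow (A * B) n = tensPow A n * tensPow B n := by
  ext x y
  simp only [tensPow, Matrix.mul_apply, ← Finset.prod_mul_distrib]
  rw [Finset.prod_univ_sum, Fintype.piFinset_univ]

lemma tensPow_diagonal {k : ℕ} (v : Fin k → ℂ) (n : ℕ) :
    tensPow (diagonal v) n = diagonal fun a => ∏ j, v (a j) := by
  ext x y
  by_cases h : x = y
  · subst h; simp [tensPow]
  · obtain ⟨j, hj⟩ := Function.ne_iff.1 h
    rw [Matrix.diagonal_apply_ne _ h]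
    exact Finset.prod_eq_zero (Finset.mem_univ j) (Matrix.diagonal_apply_ne _ hj)

lemma tensPow_one {k : ℕ} (n : ℕ) : tensPow (1 : Matrix (Fin k) (Fin k) ℂ) n = 1 := by
  rw [← Matrix.diagonal_one, tensPow_diagonal]
  simp

lemma tensPow_conjTranspose {k : ℕ} (A : Matrix (Fin k) (Fin k) ℂ) (n : ℕ) :
    tensPow Aᴴ n = (tensPow A n)ᴴ := by
  ext x y
  simp [tensPow, Matrix.conjTranspose_apply]

/-- Log-variance bound for a measurement, in an eigenbasis `V` of the state. -/
lemma sum_mul_log_sub_sq_le {d ι κ : Type*} [Fintype d] [DecidableEq d] [Fintype ι] [Fintype κ]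
    {V σ : Matrix d d ℂ} {l : d → ℝ} (hV : Vᴴ * V = 1)
    (hσ : σ = V * diagonal (fun a => (l a : ℂ)) * Vᴴ)
    (hl : ∀ a, 0 < l a) (hl1 : ∑ a, l a = 1) {E : ι → Matrix d d ℂ} {M : κ → Matrix d d ℂ}
    (hE : IsPVM E) (hM : IsPVM M) (hRef : Refines M E) (hcomm : ∀ i, E i * σ = σ * E i)
    (hw3 : 3 ≤ pvmWidth E) (hMrank : pvmWidth M = 1) (c : ℝ) :
    ∑ i, (M i * σ).trace.re * (Real.log (M i * σ).trace.re - c) ^ 2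
      ≤ 8 * Real.log (pvmWidth E) ^ 2 + 2 * ∑ a, l a * (Real.log (l a) - c) ^ 2 := by
  obtain ⟨f, hf⟩ := hRef
  have hV' : V * Vᴴ = 1 := mul_eq_one_comm.1 hV
  have hN := hM.conj hV
  have hF := hE.conj hV
  set N : κ → Matrix d d ℂ := fun i => Vᴴ * M i * V with hNdef
  set F : ι → Matrix d d ℂ := fun i => Vᴴ * E i * V with hFdef
  have hFsum : ∀ e, F e = ∑ j with f j = e, N j := fun e => by
    simp only [hFdef, hNdef, hf e, Finset.mul_sum, Finset.sum_mul]
  have hFN : ∀ i, F (f i) * N i = N i := fun i => by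
    rw [hFsum, Finset.sum_mul, Finset.sum_eq_single i]
    · exact hN.idem i
    · exact fun j _ hj => hN.orth j i hj
    · simp
  have hFc : ∀ e, F e * diagonal (fun a => (l a : ℂ)) = diagonal (fun a => (l a : ℂ)) * F e := by
    intro e
    have hD : diagonal (fun a => (l a : ℂ)) = Vᴴ * σ * V := by
      rw [hσ]
      calc _ = Vᴴ * V * diagonal (fun a => (l a : ℂ)) * (Vᴴ * V) := by
            rw [hV, Matrix.one_mul, Matrix.mul_one]
        _ = _ := by simp only [Matrix.mul_assoc]
    have hmul : ∀ A B : Matrix d d ℂ, Vᴴ * A * V * (Vᴴ * B * V) = Vᴴ * (A * B) * V := by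
      intro A B
      calc _ = Vᴴ * A * (V * Vᴴ) * B * V := by simp only [Matrix.mul_assoc]
        _ = _ := by rw [hV', Matrix.mul_one, Matrix.mul_assoc Vᴴ A B]
    rw [hD, hmul, hmul, hcomm]
  have hp : ∀ i, (M i * σ).trace.re = ∑ a, l a * (N i a a).re := by
    intro i
    have h1 : (M i * σ).trace = (N i * diagonal (fun a => (l a : ℂ))).trace := by
      rw [hσ, ← Matrix.mul_assoc, Matrix.trace_mul_comm]
      simp only [hNdef, Matrix.mul_assoc]
    rw [h1, Matrix.trace, Complex.re_sum]
    refine Finset.sum_congr rfl fun a _ => ?_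
    rw [Matrix.diag_apply, Matrix.mul_diagonal, Complex.re_mul_ofReal, mul_comm]
  have hq1 : ∀ a, ∑ i, (N i a a).re = 1 := fun a => by
    rw [← Complex.re_sum, ← Matrix.sum_apply, hN.sum_one, Matrix.one_apply_eq, Complex.one_re]
  have hbound := sum_mul_log_sub_log_sq_le l (fun a i => (N i a a).re)
    (fun i => (M i * σ).trace.re) f (pvmWidth E) hl hl1
    (fun a i => by
      rw [← sum_norm_sq_row (hN.herm i) (hN.idem i)]; positivity)
    hq1
    (fun i => by
      have h1 : (N i).trace = 1 := by
        rw [hNdef]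
        simp only
        rw [Matrix.trace_mul_comm, ← Matrix.mul_assoc, hV', Matrix.one_mul]
        exact hM.trace_eq_one_of_pvmWidth_eq_one hMrank i
      rw [← Complex.re_sum]
      exact congrArg Complex.re h1)
    hp
    (fun a i => by
      have h1 := mul_diag_le_of_commute hl (hN.herm i) (hN.idem i) (hF.herm (f i))
        (hF.idem (f i)) (hFN i) (hFc (f i)) a
      have h2 : (F (f i) a a).re = ∑ j with f j = f i, (N j a a).re := by
        rw [hFsum, Matrix.sum_apply, Complex.re_sum]
      rwa [h2, ← hp i] at h1)
    hw3
    (fun e => by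
      have h1 : ((Finset.univ.filter fun i => f i = e).card : ℂ) = (E e).rank := by
        rw [← trace_eq_rank_of_idem (hE.idem e), hf e, Matrix.trace_sum,
          Finset.sum_congr rfl fun i _ => hM.trace_eq_one_of_pvmWidth_eq_one hMrank i]
        simp
      rw [Nat.cast_inj.1 h1]
      exact Finset.le_sup (f := fun i => (E i).rank) (Finset.mem_univ e))
  calc ∑ i, (M i * σ).trace.re * (Real.log (M i * σ).trace.re - c) ^ 2
      = ∑ a, ∑ i, l a * (N i a a).re * (Real.log (M i * σ).trace.re - c) ^ 2 := by
        rw [Finset.sum_comm]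
        refine Finset.sum_congr rfl fun i _ => ?_
        rw [← Finset.sum_mul, ← hp]
    _ ≤ ∑ a, ∑ i, (2 * (l a * (N i a a).re
            * (Real.log (M i * σ).trace.re - Real.log (l a)) ^ 2)
          + 2 * (l a * (Real.log (l a) - c) ^ 2) * (N i a a).re) := by
        refine Finset.sum_le_sum fun a _ => Finset.sum_le_sum fun i _ => ?_
        have h1 : 0 ≤ l a * (N i a a).re := mul_nonneg (hl a).le (by
          rw [← sum_norm_sq_row (hN.herm i) (hN.idem i)]; positivity)
        nlinarith [mul_nonneg h1 (sq_nonneg ((Real.log (M i * σ).trace.re - Real.log (l a))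
          - (Real.log (l a) - c)))]
    _ = 2 * (∑ a, ∑ i, l a * (N i a a).re
            * (Real.log (M i * σ).trace.re - Real.log (l a)) ^ 2)
          + 2 * ∑ a, l a * (Real.log (l a) - c) ^ 2 := by
        simp_rw [Finset.sum_add_distrib, ← Finset.mul_sum, hq1, mul_one, ← Finset.mul_sum]
    _ ≤ _ := by linarith

lemma matLog_eq_conj {k : ℕ} {ρ : Matrix (Fin k) (Fin k) ℂ} (hρ : ρ.IsHermitian) :
    matLog ρ = (hρ.eigenvectorUnitary : Matrix (Fin k) (Fin k) ℂ)
      * diagonal (fun b => (Real.log (hρ.eigenvalues b) : ℂ))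
      * (hρ.eigenvectorUnitary : Matrix (Fin k) (Fin k) ℂ)ᴴ := by
  rw [matLog, matFun, dif_pos hρ, Matrix.IsHermitian.cfc, Unitary.conjStarAlgAut_apply]
  rfl

/-- **Variance bound for the measured self-information (key step of Theorem 2).**
For a PVM `E` on `(ℂ^k)^{⊗n}` commuting with `ρ^{⊗n}` with `3 ≤ w(E) ≤ (n+1)^(k-1)` and a
rank-one PVM `M` refining `E`,
`Σ_i P_ρ⊗n(i) ((1/n) log P_ρ⊗n(i) - Tr ρ log ρ)²
  ≤ 8 ((k-1) log(n+1) / n)² + (2/n) Tr(ρ (log ρ - (Tr ρ log ρ) I)²)`. -/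
theorem stmt_18 (k n : ℕ) (hn : 0 < n)
    (ρ : Matrix (Fin k) (Fin k) ℂ) (hρ : ρ.PosDef) (hρ1 : ρ.trace = 1)
    (ι κ : Type) [Fintype ι] [Fintype κ]
    (E : ι → Matrix (Fin n → Fin k) (Fin n → Fin k) ℂ)
    (M : κ → Matrix (Fin n → Fin k) (Fin n → Fin k) ℂ)
    (hE : IsPVM E) (hM : IsPVM M) (hRef : Refines M E)
    (hcomm : ∀ i, E i * tensPow ρ n = tensPow ρ n * E i)
    (hw3 : 3 ≤ pvmWidth E) (hw : pvmWidth E ≤ (n + 1) ^ (k - 1))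
    (hMrank : pvmWidth M = 1) :
    (∑ i, (Matrix.trace (M i * tensPow ρ n)).re *
        ((1 / (n : ℝ)) * Real.log (Matrix.trace (M i * tensPow ρ n)).re
          - (Matrix.trace (ρ * matLog ρ)).re) ^ 2)
    ≤ 8 * (((k : ℝ) - 1) * Real.log ((n : ℝ) + 1) / (n : ℝ)) ^ 2
      + (2 / (n : ℝ)) *
        (Matrix.trace (ρ *
          (matLog ρ - (((Matrix.trace (ρ * matLog ρ)).re : ℂ) • (1 : Matrix (Fin k) (Fin k) ℂ))) ^ 2)).re := by
  have hρh := hρ.isHermitian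
  set U := (hρh.eigenvectorUnitary : Matrix (Fin k) (Fin k) ℂ) with hU
  set μ : Fin k → ℝ := hρh.eigenvalues with hμdef
  have hUU : Uᴴ * U = 1 := Unitary.coe_star_mul_self hρh.eigenvectorUnitary
  have hUU' : U * Uᴴ = 1 := mul_eq_one_comm.1 hUU
  have hspec : ρ = U * diagonal (fun b => (μ b : ℂ)) * Uᴴ := by
    conv_lhs => rw [hρh.spectral_theorem, Unitary.conjStarAlgAut_apply]
    rfl
  have hlog : matLog ρ = U * diagonal (fun b => (Real.log (μ b) : ℂ)) * Uᴴ := matLog_eq_conj hρh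
  have hμpos : ∀ b, 0 < μ b := hρ.eigenvalues_pos
  have hmul : ∀ v w : Fin k → ℂ, U * diagonal v * Uᴴ * (U * diagonal w * Uᴴ)
      = U * diagonal (fun b => v b * w b) * Uᴴ := by
    intro v w
    calc _ = U * diagonal v * (Uᴴ * U) * diagonal w * Uᴴ := by simp only [Matrix.mul_assoc]
      _ = _ := by rw [hUU, Matrix.mul_one, Matrix.mul_assoc U, Matrix.diagonal_mul_diagonal]
  have htrace : ∀ v : Fin k → ℂ, (U * diagonal v * Uᴴ).trace = ∑ b, v b := by
    intro v
    rw [Matrix.trace_mul_comm, ← Matrix.mul_assoc, hUU, Matrix.one_mul, Matrix.trace_diagonal]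
  have hμ1 : ∑ b, μ b = 1 := by
    have h := hρ1
    rw [hspec, htrace] at h
    exact_mod_cast h
  have hc : (ρ * matLog ρ).trace.re = ∑ b, μ b * Real.log (μ b) := by
    rw [hlog]
    conv_lhs => rw [hspec]
    rw [hmul, htrace, Complex.re_sum]
    simp only [← Complex.ofReal_mul, Complex.ofReal_re]
  set c : ℝ := (ρ * matLog ρ).trace.re with hcdef
  have hvar : (ρ * (matLog ρ - (c : ℂ) • (1 : Matrix (Fin k) (Fin k) ℂ)) ^ 2).trace.re
      = ∑ b, μ b * (Real.log (μ b) - c) ^ 2 := by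
    have h1 : matLog ρ - (c : ℂ) • (1 : Matrix (Fin k) (Fin k) ℂ)
        = U * diagonal (fun b => (Real.log (μ b) : ℂ) - c) * Uᴴ := by
      have h2 : diagonal (fun b => (Real.log (μ b) : ℂ) - c)
          = diagonal (fun b => (Real.log (μ b) : ℂ)) - (c : ℂ) • (1 : Matrix (Fin k) (Fin k) ℂ) := by
        rw [Matrix.smul_one_eq_diagonal, Matrix.diagonal_sub]
      rw [h2, Matrix.mul_sub, Matrix.sub_mul, ← hlog, Matrix.mul_smul, Matrix.mul_one,
        Matrix.smul_mul, hUU']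
    rw [h1, pow_two, hmul]
    conv_lhs => rw [hspec]
    rw [hmul, htrace, Complex.re_sum]
    refine Finset.sum_congr rfl fun b _ => ?_
    rw [← Complex.ofReal_sub, ← Complex.ofReal_mul, ← Complex.ofReal_mul, Complex.ofReal_re, pow_two]
  rw [hvar]
  have hmean : ∑ b, μ b * (Real.log (μ b) - c) = 0 := by
    simp_rw [mul_sub, Finset.sum_sub_distrib, ← Finset.sum_mul, hμ1, ← hc]
    ring
  obtain ⟨hl1, -, hl2⟩ := sum_prod_moments μ (fun b => Real.log (μ b) - c) hμ1 hmean n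
  have hlogprod : ∀ a : Fin n → Fin k,
      ∑ j, (Real.log (μ (a j)) - c) = Real.log (∏ j, μ (a j)) - n * c := by
    intro a
    rw [Real.log_prod fun j _ => (hμpos (a j)).ne', Finset.sum_sub_distrib]
    simp
  simp_rw [hlogprod] at hl2
  have hV : (tensPow U n)ᴴ * tensPow U n = 1 := by
    rw [← tensPow_conjTranspose, ← tensPow_mul, hUU, tensPow_one]
  have hσ : tensPow ρ n = tensPow U n * diagonal (fun a => ((∏ j, μ (a j) : ℝ) : ℂ))
      * (tensPow U n)ᴴ := by
    conv_lhs => rw [hspec]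
    rw [tensPow_mul, tensPow_mul, tensPow_diagonal, tensPow_conjTranspose]
    simp only [Complex.ofReal_prod]
  have hmain := sum_mul_log_sub_sq_le hV hσ (fun a => Finset.prod_pos fun j _ => hμpos (a j)) hl1
    hE hM hRef hcomm hw3 hMrank (n * c)
  rw [hl2] at hmain
  have hk : 1 ≤ k := by
    rcases Nat.eq_zero_or_pos k with rfl | hk
    · simp at hμ1
    · exact hk
  have hw0 : (0 : ℝ) < pvmWidth E := by exact_mod_cast (by omega : 0 < pvmWidth E)
  have hL : Real.log (pvmWidth E) ≤ ((k : ℝ) - 1) * Real.log ((n : ℝ) + 1) := by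
    calc Real.log (pvmWidth E) ≤ Real.log (((n : ℝ) + 1) ^ (k - 1)) :=
          Real.log_le_log hw0 (by exact_mod_cast hw)
      _ = _ := by rw [Real.log_pow, Nat.cast_sub hk, Nat.cast_one]
  have hL0 : 0 ≤ Real.log (pvmWidth E) :=
    Real.log_nonneg (by exact_mod_cast (by omega : 1 ≤ pvmWidth E))
  have hL2 : Real.log (pvmWidth E) ^ 2 ≤ (((k : ℝ) - 1) * Real.log ((n : ℝ) + 1)) ^ 2 := by
    gcongr
  have hn0 : (0 : ℝ) < n := by exact_mod_cast hn
  have hscale : ∀ i, (M i * tensPow ρ n).trace.re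
      * ((1 / (n : ℝ)) * Real.log (M i * tensPow ρ n).trace.re - c) ^ 2
      = (M i * tensPow ρ n).trace.re * (Real.log (M i * tensPow ρ n).trace.re - n * c) ^ 2
        / (n : ℝ) ^ 2 := by
    intro i
    field_simp
  simp_rw [hscale]
  rw [← Finset.sum_div, div_le_iff₀ (by positivity)]
  refine hmain.trans ?_
  have hrhs : (8 * (((k : ℝ) - 1) * Real.log ((n : ℝ) + 1) / (n : ℝ)) ^ 2
      + 2 / (n : ℝ) * ∑ b, μ b * (Real.log (μ b) - c) ^ 2) * (n : ℝ) ^ 2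
      = 8 * (((k : ℝ) - 1) * Real.log ((n : ℝ) + 1)) ^ 2
        + 2 * (n * ∑ b, μ b * (Real.log (μ b) - c) ^ 2) := by
    field_simp
  rw [hrhs]
  linarith
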